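/- arXiv:1704.04252 — 2 statements merged into one kernel-verified Lean document; each statement's English description precedes it below -/
import Mathlib

section
/- Let p ∈ (1/2, 1), let X be c_0 or l^q for some q ≥ 1, and let λ ∈ ℂ with |λ| > 1/(2p−1). Then the operator λ W_p is Devaney chaotic on X: it is hypercyclic, its set of periodic points is dense in X, and it has sensitive dependence on initial conditions. -/
open Filter

/-- The transition operator of the simple random walk on `ℤ₊` with partial reflection
at `0` and jump probability `p`: `(W_p x)_0 = (1-p) x_0 + p x_1` and
`(W_p x)_i = (1-p) x_{i-1} + p x_{i+1}` for `i ≥ 1`. -/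
noncomputable def Wop (p : ℝ) (x : ℕ → ℂ) : ℕ → ℂ := fun i =>
  if i = 0 then ((1 - p : ℝ) : ℂ) * x 0 + (p : ℂ) * x 1
  else ((1 - p : ℝ) : ℂ) * x (i - 1) + (p : ℂ) * x (i + 1)

/-- Membership in `c₀`: sequences tending to `0`. -/
def memc0 (x : ℕ → ℂ) : Prop := Filter.Tendsto x Filter.atTop (nhds 0)

/-- Membership in `ℓ^q`: `∑ ‖x n‖^q < ∞`. -/
def memlq (q : ℝ) (x : ℕ → ℂ) : Prop := Summable (fun n => ‖x n‖ ^ q)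

/-- Sup-norm distance between `x` and `z` is (at most) `ε`, coordinatewise strict form. -/
def distC0lt (x z : ℕ → ℂ) (ε : ℝ) : Prop := ∀ i, ‖x i - z i‖ < ε

/-- The `q`-th power of the `ℓ^q` distance between `x` and `z` is `< ε`. -/
def distLqlt (q : ℝ) (x z : ℕ → ℂ) (ε : ℝ) : Prop := (∑' i, ‖x i - z i‖ ^ q) < ε

/-- `T` is hypercyclic on the space given by membership predicate `mem` with
distance predicate `dlt`: some `x` in the space has dense orbit. -/
def HypercyclicOn (mem : (ℕ → ℂ) → Prop) (dlt : (ℕ → ℂ) → (ℕ → ℂ) → ℝ → Prop)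
    (T : (ℕ → ℂ) → (ℕ → ℂ)) : Prop :=
  ∃ x, mem x ∧ ∀ z, mem z → ∀ ε : ℝ, 0 < ε → ∃ n : ℕ, dlt (T^[n] x) z ε

/-- `T` is supercyclic on the space given by membership predicate `mem` with
distance predicate `dlt`: some `x` in the space has dense projective orbit. -/
def SupercyclicOn (mem : (ℕ → ℂ) → Prop) (dlt : (ℕ → ℂ) → (ℕ → ℂ) → ℝ → Prop)
    (T : (ℕ → ℂ) → (ℕ → ℂ)) : Prop :=
  ∃ x, mem x ∧ ∀ z, mem z → ∀ ε : ℝ, 0 < ε →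
    ∃ (lam : ℂ) (n : ℕ), dlt (fun i => lam * T^[n] x i) z ε

/-- `T` is frequently hypercyclic: some `x` in the space is such that for every ball
(center `z` in the space, radius `ε`), the set of times `n` with `T^[n] x` in the ball
has positive lower density. -/
def FreqHypercyclicOn (mem : (ℕ → ℂ) → Prop) (dlt : (ℕ → ℂ) → (ℕ → ℂ) → ℝ → Prop)
    (T : (ℕ → ℂ) → (ℕ → ℂ)) : Prop :=
  ∃ x, mem x ∧ ∀ z, mem z → ∀ ε : ℝ, 0 < ε →
    0 < Filter.liminf (fun N : ℕ =>
      (({n : ℕ | dlt (T^[n] x) z ε} ∩ Set.Icc 1 N).ncard : ℝ) / (N : ℝ)) Filter.atTop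

/-- `T` is Devaney chaotic: it is hypercyclic, its periodic points are dense, and it has
sensitive dependence on initial conditions. -/
def DevaneyOn (mem : (ℕ → ℂ) → Prop) (dlt : (ℕ → ℂ) → (ℕ → ℂ) → ℝ → Prop)
    (T : (ℕ → ℂ) → (ℕ → ℂ)) : Prop :=
  HypercyclicOn mem dlt T ∧
  (∀ z, mem z → ∀ ε : ℝ, 0 < ε →
    ∃ y, mem y ∧ (∃ n : ℕ, 1 ≤ n ∧ T^[n] y = y) ∧ dlt y z ε) ∧
  (∃ δ : ℝ, 0 < δ ∧ ∀ x, mem x → ∀ ε : ℝ, 0 < ε →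
    ∃ y, mem y ∧ dlt x y ε ∧ ∃ n : ℕ, ¬ dlt (T^[n] x) (T^[n] y) δ)

section Chaos

open Topology

variable {X : Type*} [NormedAddCommGroup X] [NormedSpace ℂ X]

theorem Filter.Tendsto.apply_of_continuousLinearMap {ι : Type*} {l : Filter ι} {A : ι → X →L[ℂ] X}
    {L : X →L[ℂ] X} (h : Tendsto A l (𝓝 L)) (x : X) : Tendsto (fun i => A i x) l (𝓝 (L x)) :=
  ((ContinuousLinearMap.apply ℂ X x).continuous.tendsto L).comp h

theorem tendsto_pow_apply_of_norm_lt_one {S : X →L[ℂ] X} (hS : ‖S‖ < 1) (x : X) :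
    Tendsto (fun n => (S ^ n) x) atTop (𝓝 0) := by
  simpa only [zero_apply] using
    (tendsto_pow_atTop_nhds_zero_of_norm_lt_one hS).apply_of_continuousLinearMap x

/-- Birkhoff's transitivity theorem, for an operator with a strictly contractive right inverse
and a dense set of points whose orbits tend to `0`. -/
theorem exists_dense_orbit_of_rightInverse [CompleteSpace X] [SecondCountableTopology X]
    {T S : X →L[ℂ] X} (hTS : T * S = 1) (hS : ‖S‖ < 1) {D : Set X} (hD : Dense D)
    (hT : ∀ x ∈ D, Tendsto (fun n => (T ^ n) x) atTop (𝓝 0)) :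
    ∃ x, Dense (Set.range fun n => (T ^ n) x) := by
  have key : ∀ V ∈ TopologicalSpace.countableBasis X,
      Dense (⋃ n : ℕ, (fun x => (T ^ n) x) ⁻¹' V) := by
    intro V hV
    obtain ⟨y, hy⟩ := TopologicalSpace.nonempty_of_mem_countableBasis hV
    have hVo := TopologicalSpace.isOpen_of_mem_countableBasis hV
    rw [dense_iff_inter_open]
    intro U hU hUne
    obtain ⟨x, hxU, hxD⟩ := hD.inter_open_nonempty U hU hUne
    have hSn : Tendsto (fun n => (S ^ n) y) atTop (𝓝 0) := tendsto_pow_apply_of_norm_lt_one hS y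
    have h1 : Tendsto (fun n => x + (S ^ n) y) atTop (𝓝 x) := by simpa using hSn.const_add x
    have h2 : Tendsto (fun n => (T ^ n) (x + (S ^ n) y)) atTop (𝓝 y) := by
      have : ∀ n, (T ^ n) (x + (S ^ n) y) = (T ^ n) x + y := fun n => by
        have := congrArg (fun A : X →L[ℂ] X => A y) (pow_mul_pow_eq_one n hTS)
        simpa using this
      simpa only [this, zero_add] using (hT x hxD).add_const y
    obtain ⟨n, hn1, hn2⟩ := ((h1.eventually (hU.mem_nhds hxU)).and
      (h2.eventually (hVo.mem_nhds hy))).exists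
    exact ⟨_, hn1, Set.mem_iUnion.2 ⟨n, hn2⟩⟩
  have hdense : Dense (⋂ V ∈ TopologicalSpace.countableBasis X,
      ⋃ n : ℕ, (fun x => (T ^ n) x) ⁻¹' V) :=
    dense_biInter_of_isOpen
      (fun V hV => isOpen_iUnion fun n =>
        (TopologicalSpace.isOpen_of_mem_countableBasis hV).preimage (T ^ n).continuous)
      (TopologicalSpace.countable_countableBasis X) key
  obtain ⟨x, hx⟩ := hdense.nonempty
  refine ⟨x, (TopologicalSpace.isBasis_countableBasis X).dense_iff.2 fun V hV _ => ?_⟩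
  obtain ⟨n, hn⟩ := Set.mem_iUnion.1 (Set.mem_iInter₂.1 hx V hV)
  exact ⟨_, hn, n, rfl⟩

/-- The span of eigenvectors with eigenvalue in the open unit disc. -/
def stableSpan (T : X →L[ℂ] X) : Submodule ℂ X :=
  Submodule.span ℂ {x | ∃ ν : ℂ, ‖ν‖ < 1 ∧ T x = ν • x}

theorem pow_apply_of_apply_eq_smul {T : X →L[ℂ] X} {x : X} {ν : ℂ} (h : T x = ν • x) (n : ℕ) :
    (T ^ n) x = ν ^ n • x := by
  induction n with
  | zero => simp
  | succ k ih => simp [pow_succ, h, ih, smul_smul, mul_comm]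

theorem tendsto_pow_of_mem_stableSpan {T : X →L[ℂ] X} {x : X} (hx : x ∈ stableSpan T) :
    Tendsto (fun n => (T ^ n) x) atTop (𝓝 0) := by
  induction hx using Submodule.span_induction with
  | mem x hx =>
    obtain ⟨ν, hν, h⟩ := hx
    simpa [pow_apply_of_apply_eq_smul h] using
      (tendsto_pow_atTop_nhds_zero_of_norm_lt_one hν).smul_const x
  | zero => simp
  | add x y _ _ hx hy => simpa using hx.add hy
  | smul c x _ hx => simpa using hx.const_smul c

/-- The tail `∑_{k ≥ 1} T^{kN} x` of the periodised orbit. -/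
theorem exists_forward_tail {T : X →L[ℂ] X} {x : X} (hx : x ∈ stableSpan T) :
    ∃ a : ℕ → X, Tendsto a atTop (𝓝 0) ∧ ∀ N, 1 ≤ N → (T ^ N) (a N + x) = a N := by
  induction hx using Submodule.span_induction with
  | mem x hx =>
    obtain ⟨ν, hν, h⟩ := hx
    refine ⟨fun N => (ν ^ N * (1 - ν ^ N)⁻¹) • x, ?_, fun N hN => ?_⟩
    · have h0 := tendsto_pow_atTop_nhds_zero_of_norm_lt_one hν
      have h1 : Tendsto (fun N => (1 - ν ^ N)⁻¹) atTop (𝓝 (1 - 0 : ℂ)⁻¹) :=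
        (h0.const_sub 1).inv₀ (by simp)
      simpa using (h0.mul h1).smul_const x
    · have hne : 1 - ν ^ N ≠ 0 := by
        intro h0
        have h1 : ‖ν ^ N‖ < 1 := by
          rw [norm_pow]; exact pow_lt_one₀ (norm_nonneg _) hν (by lia)
        rw [← sub_eq_zero.1 h0] at h1
        simp at h1
      rw [map_add, map_smul, pow_apply_of_apply_eq_smul h, smul_smul, ← add_smul]
      congr 1
      field_simp
      ring
  | zero => exact ⟨0, tendsto_const_nhds, by simp⟩
  | add x y _ _ hx hy =>
    obtain ⟨a, ha, ha'⟩ := hx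
    obtain ⟨b, hb, hb'⟩ := hy
    refine ⟨fun N => a N + b N, by simpa using ha.add hb, fun N hN => ?_⟩
    rw [add_add_add_comm, map_add, ha' N hN, hb' N hN]
  | smul c x _ hx =>
    obtain ⟨a, ha, ha'⟩ := hx
    refine ⟨fun N => c • a N, by simpa using ha.const_smul c, fun N hN => ?_⟩
    rw [← smul_add, map_smul, ha' N hN]

/-- The tail `∑_{k ≥ 1} S^{kN} x` of the periodised backward orbit. -/
theorem exists_backward_tail [CompleteSpace X] {T S : X →L[ℂ] X} (hTS : T * S = 1)
    (hS : ‖S‖ < 1) (x : X) :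
    ∃ b : ℕ → X, Tendsto b atTop (𝓝 0) ∧ ∀ᶠ N in atTop, (T ^ N) (b N) = b N + x := by
  have h0 := tendsto_pow_atTop_nhds_zero_of_norm_lt_one hS
  have h1 : Tendsto (fun N => Ring.inverse (1 - S ^ N)) atTop (𝓝 (Ring.inverse 1)) := by
    have h2 : Tendsto (fun N => 1 - S ^ N) atTop (𝓝 1) := by simpa using h0.const_sub 1
    exact (NormedRing.inverse_continuousAt (1 : (X →L[ℂ] X)ˣ)).tendsto.comp h2
  refine ⟨fun N => (S ^ N * Ring.inverse (1 - S ^ N)) x, ?_, ?_⟩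
  · simpa only [zero_mul, zero_apply] using (h0.mul h1).apply_of_continuousLinearMap x
  · filter_upwards [h0.norm.eventually (gt_mem_nhds (by simp : ‖(0 : X →L[ℂ] X)‖ < 1))] with N hN
    have hu : (1 - S ^ N) * Ring.inverse (1 - S ^ N) = 1 :=
      Ring.mul_inverse_cancel _ (isUnit_one_sub_of_norm_lt_one hN)
    have h3 : T ^ N * (S ^ N * Ring.inverse (1 - S ^ N))
        = S ^ N * Ring.inverse (1 - S ^ N) + 1 := by
      rw [← mul_assoc, pow_mul_pow_eq_one N hTS, one_mul]
      rw [sub_mul, one_mul, sub_eq_iff_eq_add] at hu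
      rw [add_comm]; exact hu
    simpa using congrArg (fun A : X →L[ℂ] X => A x) h3

theorem dense_periodic_of_rightInverse [CompleteSpace X] {T S : X →L[ℂ] X} (hTS : T * S = 1)
    (hS : ‖S‖ < 1) (hD : Dense (stableSpan T : Set X)) :
    Dense {y : X | ∃ n : ℕ, 1 ≤ n ∧ (T ^ n) y = y} := by
  refine dense_iff_closure_eq.2 (Set.eq_univ_iff_forall.2 fun z => ?_)
  refine (closure_minimal (fun x hx => ?_) isClosed_closure) (hD z)
  obtain ⟨a, ha, ha'⟩ := exists_forward_tail hx
  obtain ⟨b, hb, hb'⟩ := exists_backward_tail hTS hS x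
  have hlim : Tendsto (fun N => a N + x + b N) atTop (𝓝 x) := by
    simpa using (ha.add_const x).add hb
  refine mem_closure_of_tendsto hlim ?_
  filter_upwards [hb', eventually_ge_atTop 1] with N h1 h2
  exact ⟨N, h2, by rw [map_add, ha' N h2, h1]; abel⟩

theorem exists_near_pow_sub_eq {T S : X →L[ℂ] X} (hTS : T * S = 1) (hS : ‖S‖ < 1) (x u : X)
    {ε : ℝ} (hε : 0 < ε) : ∃ y, ‖x - y‖ < ε ∧ ∃ n : ℕ, (T ^ n) x - (T ^ n) y = u := by
  have hSn : Tendsto (fun n => (S ^ n) u) atTop (𝓝 0) := tendsto_pow_apply_of_norm_lt_one hS u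
  obtain ⟨n, hn⟩ := (hSn.norm.eventually (gt_mem_nhds (by simpa using hε))).exists
  refine ⟨x - (S ^ n) u, by simpa using hn, n, ?_⟩
  simpa using congrArg (fun A : X →L[ℂ] X => A u) (pow_mul_pow_eq_one n hTS)

end Chaos

section Shift

variable {X : Type*} [NormedAddCommGroup X] [NormedSpace ℂ X]

/-- `F` and `B` act as the forward and backward unilateral shifts, `e` as the zeroth basis vector
and `φ` as the zeroth coordinate functional. -/
structure IsUnilateralShift (F B : X →L[ℂ] X) (φ : X →L[ℂ] ℂ) (e : X) : Prop where
  norm_le : ‖F‖ ≤ 1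
  back_forward : B * F = 1
  back_basis : B e = 0
  coord_forward : ∀ x, φ (F x) = 0
  coord_basis : φ e = 1
  dense : Dense (Submodule.span ℂ (Set.range fun n : ℕ => (F ^ n) e) : Set X)

/-- The reflected random walk operator built from shifts. -/
noncomputable def walkOp (F B : X →L[ℂ] X) (φ : X →L[ℂ] ℂ) (e : X) (p : ℂ) : X →L[ℂ] X :=
  p • B + (1 - p) • F + (1 - p) • φ.smulRight e

/-- The vector `∑ rⁿ Fⁿ e`. -/
noncomputable def geomVec (F : X →L[ℂ] X) (e : X) (r : ℂ) : X :=
  Ring.inverse (1 - r • F) e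

/-- An eigenvector of the random walk operator. -/
noncomputable def walkEigenvector (F : X →L[ℂ] X) (e : X) (c r : ℂ) : X :=
  (r - c) • geomVec F e r - (c / r - c) • geomVec F e (c / r)

theorem isUnit_one_sub_smul [CompleteSpace X] {F : X →L[ℂ] X} (hF : ‖F‖ ≤ 1) {r : ℂ}
    (hr : ‖r‖ < 1) : IsUnit (1 - r • F) := by
  refine isUnit_one_sub_of_norm_lt_one ?_
  rw [norm_smul]
  exact (mul_le_of_le_one_right (norm_nonneg _) hF).trans_lt hr

theorem geomVec_eq [CompleteSpace X] {F : X →L[ℂ] X} (hF : ‖F‖ ≤ 1) (e : X) {r : ℂ}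
    (hr : ‖r‖ < 1) : geomVec F e r = e + r • F (geomVec F e r) := by
  have h := congrArg (fun A : X →L[ℂ] X => A e)
    (Ring.mul_inverse_cancel _ (isUnit_one_sub_smul hF hr))
  simp only [mul_apply_eq_comp, sub_apply, smul_apply,
    one_apply_eq_self] at h
  exact sub_eq_iff_eq_add.1 h

theorem differentiableAt_geomVec [CompleteSpace X] {F : X →L[ℂ] X} (hF : ‖F‖ ≤ 1) (e : X) {r : ℂ}
    (hr : ‖r‖ < 1) : DifferentiableAt ℂ (geomVec F e) r := by
  have h1 : DifferentiableAt ℂ (fun r : ℂ => Ring.inverse (1 - r • F)) r :=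
    DifferentiableAt.comp (g := Ring.inverse) r
      (differentiableAt_inverse (isUnit_one_sub_smul hF hr)) (by fun_prop)
  exact h1.clm_apply (differentiableAt_const e)

variable {F B : X →L[ℂ] X} {φ : X →L[ℂ] ℂ} {e : X}

theorem IsUnilateralShift.walkOp_geomVec [CompleteSpace X] (h : IsUnilateralShift F B φ e) {p r : ℂ}
    (hp : p ≠ 0) (hr0 : r ≠ 0) (hr : ‖r‖ < 1) :
    walkOp F B φ e p (geomVec F e r) =
      (p * (r + (1 - p) / p / r)) • geomVec F e r + ((1 - p) * (1 - r⁻¹)) • e := by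
  have h0 := geomVec_eq h.norm_le e hr
  have hB : B (geomVec F e r) = r • geomVec F e r := by
    conv_lhs => rw [h0]
    have := congrArg (fun A : X →L[ℂ] X => A (geomVec F e r)) h.back_forward
    simp only [mul_apply_eq_comp, one_apply_eq_self] at this
    simp [h.back_basis, this]
  have hφ : φ (geomVec F e r) = 1 := by
    rw [h0]; simp [h.coord_basis, h.coord_forward]
  have hF : F (geomVec F e r) = r⁻¹ • (geomVec F e r - e) := by
    rw [eq_inv_smul_iff₀ hr0, eq_sub_iff_add_eq, add_comm]; exact h0.symm
  simp only [walkOp, add_apply, smul_apply, ContinuousLinearMap.smulRight_apply, hB, hφ, hF]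
  match_scalars <;> field_simp
  ring

theorem norm_div_lt_one {c r : ℂ} (hr : ‖c‖ < ‖r‖) : ‖c / r‖ < 1 := by
  rw [norm_div, div_lt_one ((norm_nonneg _).trans_lt hr)]; exact hr

theorem IsUnilateralShift.walkOp_walkEigenvector [CompleteSpace X] (h : IsUnilateralShift F B φ e)
    {p r : ℂ} (hp : p ≠ 0) (hp1 : 1 - p ≠ 0) (hcr : ‖(1 - p) / p‖ < ‖r‖) (hr : ‖r‖ < 1) :
    walkOp F B φ e p (walkEigenvector F e ((1 - p) / p) r) =
      (p * (r + (1 - p) / p / r)) • walkEigenvector F e ((1 - p) / p) r := by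
  have hr0 : r ≠ 0 := by
    rintro rfl; simp at hcr; exact absurd hcr (not_lt.2 (by positivity))
  rw [walkEigenvector, map_sub, map_smul, map_smul, h.walkOp_geomVec hp hr0 hr,
    h.walkOp_geomVec hp (div_ne_zero (div_ne_zero hp1 hp) hr0) (norm_div_lt_one hcr)]
  match_scalars <;> field_simp <;> ring

/-- The right inverse `p⁻¹ F (1 + c F²)⁻¹` of the random walk operator, `c = (1 - p) / p`. -/
noncomputable def walkRightInverse (F : X →L[ℂ] X) (p : ℂ) : X →L[ℂ] X :=
  p⁻¹ • (F * Ring.inverse (1 + ((1 - p) / p) • F ^ 2))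

theorem norm_smul_sq_le {c : ℂ} (hF : ‖F‖ ≤ 1) : ‖c • F ^ 2‖ ≤ ‖c‖ := by
  rw [norm_smul, sq]
  refine mul_le_of_le_one_right (norm_nonneg _) ((norm_mul_le _ _).trans ?_)
  exact mul_le_one₀ hF (norm_nonneg _) hF

theorem isUnit_one_add_smul_sq [CompleteSpace X] {c : ℂ} (hF : ‖F‖ ≤ 1) (hc : ‖c‖ < 1) :
    IsUnit (1 + c • F ^ 2) := by
  have := isUnit_one_sub_of_norm_lt_one (x := -(c • F ^ 2))
    (by rw [norm_neg]; exact (norm_smul_sq_le hF).trans_lt hc)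
  rwa [sub_neg_eq_add] at this

theorem IsUnilateralShift.walkOp_mul_rightInverse [CompleteSpace X] (h : IsUnilateralShift F B φ e)
    {p : ℂ} (hp : p ≠ 0) (hc : ‖(1 - p) / p‖ < 1) :
    walkOp F B φ e p * walkRightInverse F p = 1 := by
  have h1 : walkOp F B φ e p * F = p • (1 + ((1 - p) / p) • F ^ 2) := by
    ext x
    have hBF := congrArg (fun A : X →L[ℂ] X => A x) h.back_forward
    simp only [mul_apply_eq_comp, one_apply_eq_self] at hBF
    simp only [walkOp, sq, mul_apply_eq_comp, add_apply, smul_apply,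
      ContinuousLinearMap.smulRight_apply, h.coord_forward, hBF, one_apply_eq_self]
    match_scalars <;> field_simp
    ring
  rw [walkRightInverse, mul_smul_comm, ← mul_assoc, h1, smul_mul_assoc,
    Ring.mul_inverse_cancel _ (isUnit_one_add_smul_sq h.norm_le hc), smul_smul,
    inv_mul_cancel₀ hp, one_smul]

theorem norm_walkRightInverse_le [CompleteSpace X] {p : ℂ} (hF : ‖F‖ ≤ 1)
    (hc : ‖(1 - p) / p‖ < 1) :
    ‖walkRightInverse F p‖ ≤ ‖p‖⁻¹ * (1 - ‖(1 - p) / p‖)⁻¹ := by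
  have hu := isUnit_one_add_smul_sq hF hc
  set c := (1 - p) / p
  set R := Ring.inverse (1 + c • F ^ 2)
  have hR : ‖R‖ ≤ (1 - ‖c‖)⁻¹ := by
    refine ContinuousLinearMap.opNorm_le_bound _ (inv_nonneg.2 (by linarith)) fun x => ?_
    have hx : R x = x - (c • F ^ 2) (R x) := by
      rw [eq_sub_iff_add_eq]
      simpa [-FunLike.coe_pow, R] using
        congrArg (fun A : X →L[ℂ] X => A x) (Ring.mul_inverse_cancel _ hu)
    have h2 : ‖R x‖ ≤ ‖x‖ + ‖c‖ * ‖R x‖ := by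
      calc ‖R x‖ = ‖x - (c • F ^ 2) (R x)‖ := by rw [← hx]
        _ ≤ ‖x‖ + ‖(c • F ^ 2) (R x)‖ := norm_sub_le _ _
        _ ≤ _ := by gcongr; exact ContinuousLinearMap.le_of_opNorm_le _ (norm_smul_sq_le hF) _
    rw [inv_mul_eq_div, le_div_iff₀ (by linarith)]
    linarith
  rw [walkRightInverse, norm_smul, norm_inv]
  gcongr
  calc ‖F * R‖ ≤ ‖F‖ * ‖R‖ := norm_mul_le _ _
    _ ≤ 1 * (1 - ‖c‖)⁻¹ := by gcongr
    _ = _ := one_mul _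

end Shift

section Density

open Topology

theorem isPreconnected_setOf_lt_norm_lt {a b : ℝ} (ha : 0 ≤ a) :
    IsPreconnected {z : ℂ | a < ‖z‖ ∧ ‖z‖ < b} := by
  have h : IsPreconnected ((fun q : ℝ × ℝ => (q.1 : ℂ) * Complex.exp (q.2 * Complex.I)) ''
      (Set.Ioo a b ×ˢ Set.univ)) :=
    (isPreconnected_Ioo.prod isPreconnected_univ).image _ (Continuous.continuousOn (by fun_prop))
  convert h
  ext z
  constructor
  · intro hz
    exact ⟨(‖z‖, z.arg), ⟨hz, Set.mem_univ _⟩, Complex.norm_mul_exp_arg_mul_I z⟩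
  · rintro ⟨⟨t, θ⟩, ⟨ht, -⟩, rfl⟩
    have : |t| = t := abs_of_pos (ha.trans_lt ht.1)
    simpa [Complex.norm_exp_ofReal_mul_I, this] using ht

/-- A holomorphic function on the unit disc invariant under `r ↦ c / r` near one point of the
annulus `|c| < |r| < 1` is constant. -/
theorem eq_of_eventually_eq_div {c r₀ : ℂ} (hc0 : c ≠ 0) (hc1 : ‖c‖ < 1) {Γ : ℂ → ℂ}
    (hΓ : DifferentiableOn ℂ Γ (Metric.ball 0 1)) (hr₀ : ‖c‖ < ‖r₀‖) (hr₀' : ‖r₀‖ < 1)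
    (h : ∀ᶠ r in 𝓝 r₀, Γ r = Γ (c / r)) {z : ℂ} (hz : ‖z‖ < 1) : Γ z = Γ c := by
  have hcpos : 0 < ‖c‖ := norm_pos_iff.2 hc0
  have hΓat : ∀ {r : ℂ}, ‖r‖ < 1 → DifferentiableAt ℂ Γ r := fun {r} hr =>
    hΓ.differentiableAt (Metric.isOpen_ball.mem_nhds (by simpa using hr))
  have hdiv : ∀ {r : ℂ}, ‖c‖ < ‖r‖ → DifferentiableAt ℂ (fun r => Γ (c / r)) r := by
    intro r hr
    have hr0 : r ≠ 0 := norm_pos_iff.1 (hcpos.trans hr)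
    have hin : DifferentiableAt ℂ (fun r : ℂ => c / r) r :=
      (differentiableAt_const c).div differentiableAt_id hr0
    exact DifferentiableAt.comp (g := Γ) r (hΓat (norm_div_lt_one hr)) hin
  have hopen : IsOpen {z : ℂ | ‖c‖ < ‖z‖ ∧ ‖z‖ < 1} :=
    (isOpen_lt continuous_const continuous_norm).inter (isOpen_lt continuous_norm continuous_const)
  have hann : Set.EqOn Γ (fun r => Γ (c / r)) {z : ℂ | ‖c‖ < ‖z‖ ∧ ‖z‖ < 1} := by
    refine AnalyticOnNhd.eqOn_of_preconnected_of_eventuallyEq (𝕜 := ℂ) (z₀ := r₀) ?_ ?_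
      (isPreconnected_setOf_lt_norm_lt hcpos.le) ⟨hr₀, hr₀'⟩ h
    · exact DifferentiableOn.analyticOnNhd
        (fun r hr => (hΓat hr.2).differentiableWithinAt) hopen
    · exact DifferentiableOn.analyticOnNhd
        (fun r hr => (hdiv hr.1).differentiableWithinAt) hopen
  set H : ℂ → ℂ := fun z => if ‖z‖ < 1 then Γ z else Γ (c / z) with hH
  have H1 : ∀ {z}, ‖z‖ < 1 → H z = Γ z := fun {z} hz => if_pos hz
  have H2 : ∀ {z}, ‖c‖ < ‖z‖ → H z = Γ (c / z) := fun {z} hz => by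
    by_cases hz1 : ‖z‖ < 1
    · rw [H1 hz1]; exact hann ⟨hz, hz1⟩
    · exact if_neg hz1
  have hHd : Differentiable ℂ H := by
    intro z
    by_cases hz : ‖z‖ < 1
    · refine (hΓat hz).congr_of_eventuallyEq ?_
      filter_upwards [(isOpen_lt continuous_norm continuous_const).mem_nhds hz] with w hw
      exact H1 hw
    · have hz' : ‖c‖ < ‖z‖ := hc1.trans_le (not_lt.1 hz)
      refine (hdiv hz').congr_of_eventuallyEq ?_
      filter_upwards [(isOpen_lt continuous_const continuous_norm).mem_nhds hz'] with w hw
      exact H2 hw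
  have hs1 : √‖c‖ < 1 := (Real.sqrt_lt' one_pos).2 (by simpa using hc1)
  have hsc : ‖c‖ ≤ √‖c‖ := Real.le_sqrt_of_sq_le (by nlinarith)
  have hspos : 0 < √‖c‖ := Real.sqrt_pos.2 hcpos
  have hsub : Metric.closedBall (0 : ℂ) √‖c‖ ⊆ Metric.ball 0 1 := Metric.closedBall_subset_ball hs1
  have hbdd : Bornology.IsBounded (Set.range H) := by
    refine (((isCompact_closedBall (0 : ℂ) √‖c‖).image_of_continuousOn
      (hΓ.continuousOn.mono hsub)).isBounded).subset ?_
    rintro _ ⟨z, rfl⟩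
    by_cases hz : ‖z‖ ≤ √‖c‖
    · exact ⟨z, by simpa using hz, (H1 (hz.trans_lt hs1)).symm⟩
    · rw [not_le] at hz
      refine ⟨c / z, ?_, (H2 (hsc.trans_lt hz)).symm⟩
      rw [mem_closedBall_zero_iff, norm_div, div_le_iff₀ (hspos.trans hz)]
      nlinarith [Real.mul_self_sqrt hcpos.le]
  rw [← H1 hz, ← H1 hc1]
  exact hHd.apply_eq_apply_of_bounded hbdd _ _

variable {X : Type*} [NormedAddCommGroup X] [NormedSpace ℂ X]

theorem dense_of_forall_dual_eq_zero {M : Submodule ℂ X}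
    (h : ∀ f : X →L[ℂ] ℂ, (∀ x ∈ M, f x = 0) → f = 0) : Dense (M : Set X) := by
  intro x
  by_contra hx
  obtain ⟨f, u, hf, hfx⟩ := RCLike.geometric_hahn_banach_closed_point (𝕜 := ℂ)
    ((M.restrictScalars ℝ).convex.closure) isClosed_closure (x := x) hx
  have hu : 0 < u := by simpa using hf 0 (subset_closure M.zero_mem)
  have hM : ∀ y ∈ M, f y = 0 := by
    intro y hy
    by_contra hy0
    have := hf (((u : ℂ) / f y) • y) (subset_closure (M.smul_mem _ hy))
    simp [hy0] at this
  rw [h f hM] at hfx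
  simp at hfx
  linarith

theorem eq_zero_of_forall_ne {g : ℂ → ℂ} {a : ℂ} (hg : ContinuousAt g a)
    (h : ∀ᶠ r in 𝓝 a, r ≠ a → g r = 0) : g a = 0 := by
  have h1 : Tendsto g (𝓝[≠] a) (𝓝 (g a)) := hg.tendsto.mono_left nhdsWithin_le_nhds
  refine tendsto_nhds_unique h1 (tendsto_const_nhds.congr' ?_)
  filter_upwards [eventually_nhdsWithin_iff.2 h] with r hr using hr.symm

variable {F B : X →L[ℂ] X} {φ : X →L[ℂ] ℂ} {e : X}

theorem IsUnilateralShift.dual_eq_zero [CompleteSpace X] (h : IsUnilateralShift F B φ e)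
    {c r₀ : ℂ} (hc0 : c ≠ 0) (hc1 : ‖c‖ < 1) (hr₀ : ‖c‖ < ‖r₀‖) (hr₀' : ‖r₀‖ < 1)
    (f : X →L[ℂ] ℂ) (hf : ∀ᶠ r in 𝓝 r₀, f (walkEigenvector F e c r) = 0) : f = 0 := by
  have hball : ∀ {r : ℂ}, ‖r‖ < 1 → ∀ᶠ s in 𝓝 r, ‖s‖ < 1 := fun hr =>
    (isOpen_lt continuous_norm continuous_const).mem_nhds hr
  have hcont : ∀ (g : X →L[ℂ] ℂ) {r : ℂ}, ‖r‖ < 1 →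
      DifferentiableAt ℂ (fun r => g (geomVec F e r)) r := fun g r hr =>
    g.differentiableAt.comp r (differentiableAt_geomVec h.norm_le e hr)
  have hΓ : ∀ r : ℂ, ‖r‖ < 1 → (r - c) * f (geomVec F e r) = (c - c) * f (geomVec F e c) := by
    intro r hr
    refine eq_of_eventually_eq_div (Γ := fun r => (r - c) * f (geomVec F e r)) hc0 hc1 ?_
      hr₀ hr₀' ?_ hr
    · intro s hs
      exact ((differentiableAt_id.sub_const c).mul
        (hcont f (by simpa using hs))).differentiableWithinAt
    · filter_upwards [hf] with s hs
      simpa [walkEigenvector, sub_eq_zero] using hs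
  have hΦ : ∀ r : ℂ, ‖r‖ < 1 → f (geomVec F e r) = 0 := by
    have hne : ∀ r : ℂ, ‖r‖ < 1 → r ≠ c → f (geomVec F e r) = 0 := fun r hr hrc => by
      simpa [sub_eq_zero, hrc] using hΓ r hr
    intro r hr
    by_cases hrc : r = c
    · subst hrc
      exact eq_zero_of_forall_ne (g := fun r => f (geomVec F e r)) (hcont f hr).continuousAt
        ((hball hr).mono fun s hs => hne s hs)
    · exact hne r hr hrc
  have hstep : ∀ (n : ℕ) (r : ℂ), ‖r‖ < 1 → f ((F ^ n) (geomVec F e r)) = 0 := by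
    intro n
    induction n with
    | zero => simpa using hΦ
    | succ n ih =>
      have he : f ((F ^ n) e) = 0 := by
        have := ih 0 (by simp)
        rwa [geomVec_eq h.norm_le e (by simp), zero_smul, add_zero] at this
      have hne : ∀ r : ℂ, ‖r‖ < 1 → r ≠ 0 → f ((F ^ (n + 1)) (geomVec F e r)) = 0 := by
        intro r hr hr0
        have := ih r hr
        rw [geomVec_eq h.norm_le e hr, map_add, map_add, he, zero_add, map_smul, map_smul,
          smul_eq_mul, mul_eq_zero, or_iff_right hr0] at this
        rwa [pow_succ, mul_apply_eq_comp]
      intro r hr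
      by_cases hr0 : r = 0
      · subst hr0
        exact eq_zero_of_forall_ne (g := fun r => f ((F ^ (n + 1)) (geomVec F e r)))
          (hcont (f.comp (F ^ (n + 1))) hr).continuousAt ((hball hr).mono fun s hs => hne s hs)
      · exact hne r hr hr0
  refine ContinuousLinearMap.ext_on h.dense ?_
  rintro _ ⟨n, rfl⟩
  have := hstep n 0 (by simp)
  rw [geomVec_eq h.norm_le e (by simp), zero_smul, add_zero] at this
  simpa only [zero_apply] using this

theorem IsUnilateralShift.dense_stableSpan [CompleteSpace X] (h : IsUnilateralShift F B φ e)
    {p : ℂ} (hp : p ≠ 0) (hp1 : 1 - p ≠ 0) (hc : ‖(1 - p) / p‖ < 1) (lam : ℂ) :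
    Dense (stableSpan (lam • walkOp F B φ e p) : Set X) := by
  have hc0 : (1 - p) / p ≠ 0 := div_ne_zero hp1 hp
  obtain ⟨r₀, hr⟩ := IsAlgClosed.exists_pow_nat_eq (-((1 - p) / p)) two_pos
  have hcpos := norm_pos_iff.2 hc0
  have hnorm : ‖r₀‖ ^ 2 = ‖(1 - p) / p‖ := by rw [← norm_pow, hr, norm_neg]
  have hlt1 : ‖r₀‖ < 1 := by
    by_contra! h1
    nlinarith
  have hlt : ‖(1 - p) / p‖ < ‖r₀‖ := by
    rw [← hnorm]
    nlinarith [norm_nonneg r₀]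
  have hr0 : r₀ ≠ 0 := norm_pos_iff.1 (hcpos.trans hlt)
  have hμ : r₀ + (1 - p) / p / r₀ = 0 := by
    have : r₀ * r₀ = -((1 - p) / p) := by rw [← sq, hr]
    rw [← mul_right_inj' hr0, mul_add, this, mul_div_cancel₀ _ hr0]
    simp
  refine dense_of_forall_dual_eq_zero fun f hf => h.dual_eq_zero hc0 hc hlt hlt1 f ?_
  have hcont : ContinuousAt (fun r : ℂ => ‖lam * (p * (r + (1 - p) / p / r))‖) r₀ :=
    (continuousAt_const.mul (continuousAt_const.mul
      (continuousAt_id.add (continuousAt_const.div continuousAt_id hr0)))).norm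
  have hsmall : ∀ᶠ r in 𝓝 r₀, ‖lam * (p * (r + (1 - p) / p / r))‖ < 1 :=
    hcont.eventually_lt continuousAt_const (by simp [hμ])
  filter_upwards [hsmall, (isOpen_lt continuous_norm continuous_const).mem_nhds hlt1,
    (isOpen_lt continuous_const continuous_norm).mem_nhds hlt] with r h1 h2 h3
  refine hf _ (Submodule.subset_span ⟨_, h1, ?_⟩)
  rw [smul_apply, h.walkOp_walkEigenvector hp hp1 h3 h2, smul_smul]

theorem IsUnilateralShift.secondCountableTopology (h : IsUnilateralShift F B φ e) :
    SecondCountableTopology X := by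
  have hs : TopologicalSpace.IsSeparable (Set.univ : Set X) := by
    have := (((Set.countable_range fun n : ℕ => (F ^ n) e).isSeparable).span (R := ℂ)).closure
    rwa [h.dense.closure_eq] at this
  have := TopologicalSpace.isSeparable_univ_iff.1 hs
  exact UniformSpace.secondCountable_of_separable X

/-- Transfer of chaos from a Banach space carrying unilateral shifts to the space of coordinate
sequences. -/
theorem IsUnilateralShift.devaneyOn [CompleteSpace X] (h : IsUnilateralShift F B φ e)
    {p lam : ℂ} (hp : p ≠ 0) (hp1 : 1 - p ≠ 0) (hc : ‖(1 - p) / p‖ < 1)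
    (hlam : ‖p‖⁻¹ * (1 - ‖(1 - p) / p‖)⁻¹ < ‖lam‖)
    {mem : (ℕ → ℂ) → Prop} {dlt : (ℕ → ℂ) → (ℕ → ℂ) → ℝ → Prop} {W : (ℕ → ℂ) → (ℕ → ℂ)}
    (ι : X → ℕ → ℂ) (hmem : ∀ x, mem x ↔ x ∈ Set.range ι)
    (hW : ∀ x, ι (lam • walkOp F B φ e p x) = W (ι x))
    (hdlt : ∀ ε : ℝ, 0 < ε → ∃ η : ℝ, 0 < η ∧ ∀ x y, ‖x - y‖ < η → dlt (ι x) (ι y) ε)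
    (hfar : ∀ x y, dlt (ι x) (ι y) 1 → ‖x - y‖ ≤ 1) : DevaneyOn mem dlt W := by
  have hpos : 0 < ‖lam‖ := by
    refine lt_of_le_of_lt ?_ hlam
    have : 0 < 1 - ‖(1 - p) / p‖ := by linarith
    positivity
  have hlam0 : lam ≠ 0 := norm_pos_iff.1 hpos
  set T : X →L[ℂ] X := lam • walkOp F B φ e p with hT
  set S : X →L[ℂ] X := lam⁻¹ • walkRightInverse F p with hSdef
  have hTS : T * S = 1 := by
    rw [hT, hSdef, smul_mul_smul_comm, mul_inv_cancel₀ hlam0, one_smul,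
      h.walkOp_mul_rightInverse hp hc]
  have hS : ‖S‖ < 1 := by
    rw [hSdef, norm_smul, norm_inv, inv_mul_lt_one₀ hpos]
    exact (norm_walkRightInverse_le h.norm_le hc).trans_lt hlam
  have hD := h.dense_stableSpan hp hp1 hc lam
  have := h.secondCountableTopology
  have hiter : ∀ (n : ℕ) (x : X), W^[n] (ι x) = ι ((T ^ n) x) := by
    intro n x
    have hsemi : Function.Semiconj ι T W := hW
    rw [show (T ^ n) x = T^[n] x by simp]
    exact ((hsemi.iterate_right n).eq x).symm
  refine ⟨?_, ?_, 1, one_pos, ?_⟩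
  · obtain ⟨x, hx⟩ := exists_dense_orbit_of_rightInverse hTS hS hD
      fun x hx => tendsto_pow_of_mem_stableSpan hx
    refine ⟨ι x, (hmem _).2 ⟨x, rfl⟩, fun z hz ε hε => ?_⟩
    obtain ⟨z, rfl⟩ := (hmem z).1 hz
    obtain ⟨η, hη, hlt⟩ := hdlt ε hε
    obtain ⟨_, ⟨n, rfl⟩, hn⟩ := hx.exists_dist_lt z hη
    refine ⟨n, ?_⟩
    rw [hiter]
    exact hlt _ _ (by rwa [← dist_eq_norm, dist_comm])
  · intro z hz ε hε
    obtain ⟨z, rfl⟩ := (hmem z).1 hz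
    obtain ⟨η, hη, hlt⟩ := hdlt ε hε
    obtain ⟨y, ⟨n, hn, hy⟩, hyz⟩ := (dense_periodic_of_rightInverse hTS hS hD).exists_dist_lt z hη
    refine ⟨ι y, (hmem _).2 ⟨y, rfl⟩, ⟨n, hn, by rw [hiter, hy]⟩, hlt _ _ ?_⟩
    rwa [← dist_eq_norm, dist_comm]
  · intro x hx ε hε
    obtain ⟨x, rfl⟩ := (hmem x).1 hx
    obtain ⟨η, hη, hlt⟩ := hdlt ε hε
    have he : e ≠ 0 := by
      rintro rfl
      simpa using h.coord_basis
    obtain ⟨y, hy, n, hn⟩ := exists_near_pow_sub_eq hTS hS x ((2 / ‖e‖ : ℂ) • e) hη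
    refine ⟨ι y, (hmem _).2 ⟨y, rfl⟩, hlt _ _ hy, n, fun hd => ?_⟩
    rw [hiter, hiter] at hd
    have := hfar _ _ hd
    rw [hn, norm_smul] at this
    norm_num [he] at this

end Density

section Coordinates

/-- The forward shift of sequences. -/
def shiftForward (x : ℕ → ℂ) : ℕ → ℂ
  | 0 => 0
  | n + 1 => x n

variable {X : Type*} [NormedAddCommGroup X] [NormedSpace ℂ X]

/-- Chaos of the reflected random walk on a Banach sequence space on which both shifts act
contractively and in which finite sequences are dense. -/
theorem devaneyOn_of_coordinates [CompleteSpace X] (ι : X →ₗ[ℂ] ℕ → ℂ) (hι : Function.Injective ι)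
    (hfwd : ∀ x, ∃ y, ‖y‖ ≤ ‖x‖ ∧ ι y = shiftForward (ι x))
    (hbwd : ∀ x, ∃ y, ‖y‖ ≤ ‖x‖ ∧ ι y = fun n => ι x (n + 1))
    (hcoord : ∀ x, ‖ι x 0‖ ≤ ‖x‖) (b : ℕ → X) (hb : ∀ n, ι (b n) = Pi.single n 1)
    (hdense : Dense (Submodule.span ℂ (Set.range b) : Set X))
    {p : ℝ} (hp : 1 / 2 < p) (hp1 : p < 1) {lam : ℂ} (hlam : 1 / (2 * p - 1) < ‖lam‖)
    {mem : (ℕ → ℂ) → Prop} {dlt : (ℕ → ℂ) → (ℕ → ℂ) → ℝ → Prop}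
    (hmem : ∀ x, mem x ↔ x ∈ Set.range ι)
    (hdlt : ∀ ε : ℝ, 0 < ε → ∃ η : ℝ, 0 < η ∧ ∀ x y, ‖x - y‖ < η → dlt (ι x) (ι y) ε)
    (hfar : ∀ x y, dlt (ι x) (ι y) 1 → ‖x - y‖ ≤ 1) :
    DevaneyOn mem dlt (fun x i => lam * Wop p x i) := by
  choose f hf hf' using hfwd
  choose g hg hg' using hbwd
  let F : X →L[ℂ] X := LinearMap.mkContinuous
    { toFun := f
      map_add' := fun x y => hι <| by
        ext n; cases n <;> simp [hf', shiftForward]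
      map_smul' := fun c x => hι <| by
        ext n; cases n <;> simp [hf', shiftForward] } 1 (by simpa using hf)
  let B : X →L[ℂ] X := LinearMap.mkContinuous
    { toFun := g
      map_add' := fun x y => hι <| by ext n; simp [hg']
      map_smul' := fun c x => hι <| by ext n; simp [hg'] } 1 (by simpa using hg)
  let φ : X →L[ℂ] ℂ := LinearMap.mkContinuous ((LinearMap.proj 0).comp ι) 1 (by simpa using hcoord)
  have hF : ∀ x, ι (F x) = shiftForward (ι x) := hf'
  have hB : ∀ x, ι (B x) = fun n => ι x (n + 1) := hg'
  have hφ : ∀ x, φ x = ι x 0 := fun x => rfl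
  have hFb : ∀ n, F (b n) = b (n + 1) := fun n => hι <| by
    rw [hF, hb, hb]
    ext m
    cases m <;> simp [shiftForward, Pi.single_apply]
  have hpow : ∀ n, (F ^ n) (b 0) = b n := by
    intro n
    induction n with
    | zero => rfl
    | succ n ih => rw [pow_succ', mul_apply_eq_comp, ih, hFb]
  have h : IsUnilateralShift F B φ (b 0) :=
    { norm_le := LinearMap.mkContinuous_norm_le _ zero_le_one _
      back_forward := by
        ext x
        exact hι (by rw [mul_apply_eq_comp, hB, hF]; rfl)
      back_basis := hι (by rw [hB, hb]; ext n; simp)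
      coord_forward := fun x => by rw [hφ, hF]; rfl
      coord_basis := by rw [hφ, hb]; simp
      dense := by simpa only [hpow] using hdense }
  have hp0 : (p : ℂ) ≠ 0 := Complex.ofReal_ne_zero.2 (by linarith)
  have hc : ‖(1 - (p : ℂ)) / p‖ = (1 - p) / p := by
    rw [← Complex.ofReal_one, ← Complex.ofReal_sub, ← Complex.ofReal_div, Complex.norm_real,
      Real.norm_of_nonneg (div_nonneg (by linarith) (by linarith))]
  refine h.devaneyOn (p := p) (lam := lam) hp0 ?_ ?_ ?_ ι hmem ?_ hdlt hfar
  · exact_mod_cast (sub_pos.2 hp1).ne'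
  · rw [hc, div_lt_one (by linarith)]; linarith
  · rw [hc, Complex.norm_real, Real.norm_of_nonneg (by linarith)]
    convert hlam using 1
    have : p ≠ 0 := by linarith
    have : 2 * p - 1 ≠ 0 := by linarith
    have : 1 - (1 - p) / p = (2 * p - 1) / p := by field_simp; ring
    rw [this]
    field_simp
  · intro x
    ext i
    simp only [walkOp, add_apply, smul_apply, ContinuousLinearMap.smulRight_apply, map_add, map_smul,
      Pi.add_apply, Pi.smul_apply, hF, hB, hb, hφ, smul_eq_mul, Wop]
    cases i with
    | zero => simp [-mul_eq_mul_left_iff, shiftForward]; ring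
    | succ i => simp [-mul_eq_mul_left_iff, shiftForward]; ring

end Coordinates

section ZeroAtInfty

open Topology ZeroAtInfty

/-- A null sequence as an element of `C₀(ℕ, ℂ)`. -/
def nullSequence (x : ℕ → ℂ) (hx : Tendsto x atTop (𝓝 0)) : C₀(ℕ, ℂ) where
  toFun := x
  continuous_toFun := continuous_of_discreteTopology
  zero_at_infty' := by rwa [cocompact_eq_cofinite, Nat.cofinite_eq_atTop]

theorem ZeroAtInftyContinuousMap.tendsto_atTop (f : C₀(ℕ, ℂ)) : Tendsto f atTop (𝓝 0) := by
  have h := f.zero_at_infty'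
  rwa [cocompact_eq_cofinite, Nat.cofinite_eq_atTop] at h

theorem ZeroAtInftyContinuousMap.norm_le {f : C₀(ℕ, ℂ)} {C : ℝ} (hC : 0 ≤ C) :
    ‖f‖ ≤ C ↔ ∀ n, ‖f n‖ ≤ C := by
  rw [← norm_toBCF_eq_norm, BoundedContinuousFunction.norm_le hC]
  rfl

theorem ZeroAtInftyContinuousMap.norm_apply_le (f : C₀(ℕ, ℂ)) (n : ℕ) : ‖f n‖ ≤ ‖f‖ :=
  (norm_le (norm_nonneg f)).1 le_rfl n

/-- Coordinates on `C₀(ℕ, ℂ)`. -/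
noncomputable def nullSequenceCoords : C₀(ℕ, ℂ) →ₗ[ℂ] ℕ → ℂ where
  toFun f := f
  map_add' _ _ := rfl
  map_smul' _ _ := rfl

theorem tendsto_pi_single (n : ℕ) : Tendsto (Pi.single n 1 : ℕ → ℂ) atTop (𝓝 0) :=
  tendsto_const_nhds.congr' <| by
    filter_upwards [eventually_gt_atTop n] with m hm
    simp [hm.ne']

theorem dense_span_nullSequence_single :
    Dense (Submodule.span ℂ (Set.range fun n => nullSequence _ (tendsto_pi_single n)) :
      Set C₀(ℕ, ℂ)) := by
  rw [Metric.dense_iff]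
  intro f ε hε
  have hf := f.tendsto_atTop.norm.eventually_lt_const
    (show ‖(0 : ℂ)‖ < ε / 2 by rw [norm_zero]; exact half_pos hε)
  obtain ⟨N, hN⟩ := eventually_atTop.1 hf
  set g : C₀(ℕ, ℂ) := ∑ i ∈ Finset.range N, f i • nullSequence _ (tendsto_pi_single i) with hg
  have hgn : ∀ n, g n = if n < N then f n else 0 := by
    intro n
    have h1 : g n = nullSequenceCoords g n := rfl
    rw [h1, hg, map_sum, Finset.sum_apply]
    have h2 : ∀ i, nullSequenceCoords (f i • nullSequence _ (tendsto_pi_single i)) n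
        = if n = i then f i else 0 := by
      intro i
      change f i * (Pi.single i 1 : ℕ → ℂ) n = _
      simp [Pi.single_apply]
    simp [h2]
  refine ⟨g, ?_, Submodule.sum_mem _ fun i _ =>
    Submodule.smul_mem _ _ (Submodule.subset_span ⟨i, rfl⟩)⟩
  rw [Metric.mem_ball, dist_eq_norm]
  refine lt_of_le_of_lt ((ZeroAtInftyContinuousMap.norm_le (half_pos hε).le).2 fun n => ?_)
    (half_lt_self hε)
  rw [ZeroAtInftyContinuousMap.sub_apply, hgn]
  split_ifs with h
  · simpa using (half_pos hε).le
  · simpa using (hN n (not_lt.1 h)).le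

theorem devaneyOn_memc0 {p : ℝ} (hp : 1 / 2 < p) (hp1 : p < 1) {lam : ℂ}
    (hlam : 1 / (2 * p - 1) < ‖lam‖) :
    DevaneyOn memc0 distC0lt (fun x i => lam * Wop p x i) := by
  refine devaneyOn_of_coordinates nullSequenceCoords DFunLike.coe_injective ?_ ?_
    (fun f => f.norm_apply_le 0) _ (fun n => rfl) dense_span_nullSequence_single hp hp1 hlam
    ?_ ?_ ?_
  · intro f
    refine ⟨nullSequence (shiftForward f) ?_, ?_, rfl⟩
    · exact (tendsto_add_atTop_iff_nat 1).1 f.tendsto_atTop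
    · refine (ZeroAtInftyContinuousMap.norm_le (norm_nonneg f)).2 fun n => ?_
      cases n with
      | zero => exact norm_zero.trans_le (norm_nonneg f)
      | succ n => exact f.norm_apply_le n
  · intro f
    refine ⟨nullSequence (fun n => f (n + 1)) ?_, ?_, rfl⟩
    · exact (tendsto_add_atTop_iff_nat 1).2 f.tendsto_atTop
    · exact (ZeroAtInftyContinuousMap.norm_le (norm_nonneg f)).2 fun n => f.norm_apply_le (n + 1)
  · refine fun x => ⟨fun hx => ⟨nullSequence x hx, rfl⟩, ?_⟩
    rintro ⟨f, rfl⟩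
    exact f.tendsto_atTop
  · exact fun ε hε => ⟨ε, hε, fun f g h n => ((f - g).norm_apply_le n).trans_lt h⟩
  · exact fun f g h => (ZeroAtInftyContinuousMap.norm_le zero_le_one).2 fun n => (h n).le

end ZeroAtInfty

section Lq

/-- Coordinates on `ℓ^q`. -/
noncomputable def lpCoords (q : ENNReal) : lp (fun _ : ℕ => ℂ) q →ₗ[ℂ] ℕ → ℂ where
  toFun f := f
  map_add' _ _ := rfl
  map_smul' _ _ := rfl

theorem dense_span_lp_single {q : ENNReal} [Fact (1 ≤ q)] (hq : q ≠ ⊤) :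
    Dense (Submodule.span ℂ (Set.range fun n => lp.single (E := fun _ : ℕ => ℂ) q n 1) :
      Set (lp (fun _ : ℕ => ℂ) q)) := by
  intro f
  refine mem_closure_of_tendsto (lp.hasSum_single hq f) (Eventually.of_forall fun s => ?_)
  refine Submodule.sum_mem _ fun i _ => ?_
  have : lp.single q i (f i) = f i • lp.single (E := fun _ : ℕ => ℂ) q i 1 := by
    rw [← lp.single_smul]; simp
  rw [this]
  exact Submodule.smul_mem _ _ (Submodule.subset_span ⟨i, rfl⟩)

theorem devaneyOn_memlq {q : ℝ} (hq : 1 ≤ q) {p : ℝ} (hp : 1 / 2 < p) (hp1 : p < 1) {lam : ℂ}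
    (hlam : 1 / (2 * p - 1) < ‖lam‖) :
    DevaneyOn (memlq q) (distLqlt q) (fun x i => lam * Wop p x i) := by
  have hq0 : 0 < q := by linarith
  have hqr : (ENNReal.ofReal q).toReal = q := ENNReal.toReal_ofReal hq0.le
  have hpos : 0 < (ENNReal.ofReal q).toReal := by rwa [hqr]
  have : Fact (1 ≤ ENNReal.ofReal q) := ⟨by simpa using hq⟩
  have hmem : ∀ x : ℕ → ℂ, Memℓp x (ENNReal.ofReal q) ↔ memlq q x := fun x => by
    rw [memℓp_gen_iff hpos, hqr]; rfl
  have hsum : ∀ f : lp (fun _ : ℕ => ℂ) (ENNReal.ofReal q), Summable fun n => ‖f n‖ ^ q :=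
    fun f => (hmem _).1 (lp.memℓp f)
  have hnorm : ∀ f : lp (fun _ : ℕ => ℂ) (ENNReal.ofReal q), ‖f‖ ^ q = ∑' n, ‖f n‖ ^ q :=
    fun f => by simpa only [hqr] using lp.norm_rpow_eq_tsum hpos f
  have hle : ∀ f g : lp (fun _ : ℕ => ℂ) (ENNReal.ofReal q),
      ∑' n, ‖f n‖ ^ q ≤ ∑' n, ‖g n‖ ^ q → ‖f‖ ≤ ‖g‖ := fun f g h => by
    rwa [← hnorm, ← hnorm, Real.rpow_le_rpow_iff (norm_nonneg _) (norm_nonneg _) hq0] at h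
  refine devaneyOn_of_coordinates (lpCoords (ENNReal.ofReal q)) (fun f g h => lp.ext h) ?_ ?_
    (fun f => lp.norm_apply_le_norm (zero_lt_one.trans_le Fact.out).ne' f 0) _
    (fun n => rfl) (dense_span_lp_single ENNReal.ofReal_ne_top) hp hp1 hlam ?_ ?_ ?_
  · intro f
    have hs : Summable fun n => ‖shiftForward f n‖ ^ q := (summable_nat_add_iff 1).1 (hsum f)
    refine ⟨⟨shiftForward f, (hmem _).2 hs⟩, hle _ _ ?_, rfl⟩
    change ∑' n, ‖shiftForward f n‖ ^ q ≤ _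
    rw [hs.tsum_eq_zero_add]
    simp [shiftForward, Real.zero_rpow hq0.ne']
  · intro f
    have hs : Summable fun n => ‖f (n + 1)‖ ^ q := (summable_nat_add_iff 1).2 (hsum f)
    refine ⟨⟨fun n => f (n + 1), (hmem _).2 hs⟩, hle _ _ ?_, rfl⟩
    rw [(hsum f).tsum_eq_zero_add]
    exact le_add_of_nonneg_left (by positivity)
  · refine fun x => ⟨fun hx => ⟨⟨x, (hmem x).2 hx⟩, rfl⟩, ?_⟩
    rintro ⟨f, rfl⟩
    exact hsum f
  · refine fun ε hε => ⟨ε ^ q⁻¹, by positivity, fun f g h => ?_⟩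
    change ∑' n, ‖(f - g) n‖ ^ q < ε
    rw [← hnorm]
    calc ‖f - g‖ ^ q < (ε ^ q⁻¹) ^ q := Real.rpow_lt_rpow (norm_nonneg _) h hq0
      _ = ε := Real.rpow_inv_rpow hε.le hq0.ne'
  · intro f g h
    have h1 : ∑' n, ‖(f - g) n‖ ^ q < 1 := h
    rw [← hnorm] at h1
    by_contra! h2
    exact (Real.one_le_rpow h2.le hq0.le).not_gt h1

end Lq

/-- For `p ∈ (1/2, 1)` and `λ ∈ ℂ` with `|λ| > 1/(2p-1)`, the operator `λ W_p` is
Devaney chaotic on `c₀` and on every `ℓ^q`, `q ≥ 1`: it is hypercyclic, its periodic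
points are dense, and it has sensitive dependence on initial conditions. -/
theorem stmt8 (p : ℝ) (hp : 1/2 < p) (hp1 : p < 1)
    (lam : ℂ) (hlam : 1 / (2*p - 1) < ‖lam‖) :
    DevaneyOn memc0 distC0lt (fun x i => lam * Wop p x i) ∧
    ∀ q : ℝ, 1 ≤ q →
      DevaneyOn (memlq q) (distLqlt q) (fun x i => lam * Wop p x i) := by
  exact ⟨devaneyOn_memc0 hp hp1 hlam, fun q hq => devaneyOn_memlq hq hp hp1 hlam⟩
end

section
/- Let p ∈ (1/2, 1) and let X be c_0 or l^q for some q ≥ 1. Then the union of kernels D = ⋃_{n≥1} Ker(W_p^n) = {u ∈ X : W_p^n u = 0 for some n ≥ 1} is a dense subspace of X. -/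
open Filter

section Resolvent

variable {E F : Type*} [NormedAddCommGroup E] [NormedSpace ℂ E]
  [NormedAddCommGroup F] [NormedSpace ℂ F]

/-- The resolvent `(1 - ζ S)⁻¹`. -/
noncomputable def resolv (S : E →L[ℂ] E) (ζ : ℂ) : E →L[ℂ] E := Ring.inverse (1 - ζ • S)

theorem norm_smul_lt_one {S : E →L[ℂ] E} (hS : ‖S‖ ≤ 1) {ζ : ℂ} (hζ : ‖ζ‖ < 1) :
    ‖ζ • S‖ < 1 := by
  rw [norm_smul]
  nlinarith [norm_nonneg ζ, norm_nonneg S]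

theorem resolv_comm (S : E →L[ℂ] E) (ζ η : ℂ) (x : E) :
    resolv S ζ (resolv S η x) = resolv S η (resolv S ζ x) := by
  have hc : Commute (1 - ζ • S) (1 - η • S) := by
    refine Commute.sub_left (Commute.one_left _) (Commute.sub_right (Commute.one_right _) ?_)
    exact ((Commute.refl S).smul_left ζ).smul_right η
  exact congrArg (fun A : E →L[ℂ] E => A x) hc.ringInverse_ringInverse.eq

variable [CompleteSpace E]

theorem isUnit_one_sub_smul_s13 {S : E →L[ℂ] E} (hS : ‖S‖ ≤ 1) {ζ : ℂ} (hζ : ‖ζ‖ < 1) :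
    IsUnit (1 - ζ • S) :=
  isUnit_one_sub_of_norm_lt_one (norm_smul_lt_one hS hζ)

theorem differentiableAt_resolv {S : E →L[ℂ] E} (hS : ‖S‖ ≤ 1) {ζ : ℂ} (hζ : ‖ζ‖ < 1) :
    DifferentiableAt ℂ (resolv S) ζ :=
  (differentiableAt_inverse (isUnit_one_sub_smul_s13 hS hζ)).comp ζ
    (f := fun ζ : ℂ => 1 - ζ • S) (by fun_prop)

theorem one_sub_smul_resolv {S : E →L[ℂ] E} (hS : ‖S‖ ≤ 1) {ζ : ℂ} (hζ : ‖ζ‖ < 1) (x : E) :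
    resolv S ζ x - ζ • S (resolv S ζ x) = x := by
  have h := Ring.mul_inverse_cancel _ (isUnit_one_sub_smul_s13 hS hζ)
  simpa [resolv] using congrArg (fun A : E →L[ℂ] E => A x) h

theorem resolv_one_sub_smul {S : E →L[ℂ] E} (hS : ‖S‖ ≤ 1) {ζ : ℂ} (hζ : ‖ζ‖ < 1) (x : E) :
    resolv S ζ (x - ζ • S x) = x := by
  have h := Ring.inverse_mul_cancel _ (isUnit_one_sub_smul_s13 hS hζ)
  simpa [resolv] using congrArg (fun A : E →L[ℂ] E => A x) h

/-- Partial fractions for the product of two resolvents. -/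
theorem smul_resolv_sub_smul_resolv {S : E →L[ℂ] E} (hS : ‖S‖ ≤ 1) {ζ η : ℂ} (hζ : ‖ζ‖ < 1)
    (hη : ‖η‖ < 1) (x : E) :
    ζ • resolv S ζ x - η • resolv S η x = (ζ - η) • resolv S ζ (resolv S η x) := by
  have h1 := one_sub_smul_resolv hS hζ (resolv S η x)
  have h2 := one_sub_smul_resolv hS hη (resolv S ζ x)
  rw [resolv_comm S η ζ x] at h2
  generalize resolv S ζ (resolv S η x) = k at *
  rw [← h1, ← h2]
  module

/-- If `π` kills the orbit of `u` under `V`, it kills `(1 - l V)⁻¹ u` for small `l`. -/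
theorem map_eq_zero_of_eq_add_smul {V : E →L[ℂ] E} {π : E →L[ℂ] F} {u k : E} {l : ℂ}
    (hπ : ∀ n : ℕ, π ((V ^ n) u) = 0) (hl : ‖l • V‖ < 1) (hk : k = l • V k + u) : π k = 0 := by
  have hk' : k = (∑' n : ℕ, (l • V) ^ n) u := by
    have h := congrArg (fun A : E →L[ℂ] E => A k) (geom_series_mul_neg (l • V) hl)
    have hu : (1 - l • V) k = u := by
      simp only [sub_apply, one_apply_eq_self, smul_apply]
      nth_rewrite 1 [hk]
      abel
    simp only [mul_apply_eq_comp, hu, one_apply_eq_self] at h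
    exact h.symm
  have hs := (π.comp (ContinuousLinearMap.apply ℂ E u)).hasSum
    (summable_geometric_of_norm_lt_one hl).hasSum
  have h0 : (fun n : ℕ => (π.comp (ContinuousLinearMap.apply ℂ E u)) ((l • V) ^ n))
      = fun _ => 0 := by
    funext n
    rw [smul_pow, map_smul]
    exact (congrArg (l ^ n • ·) (hπ n)).trans (smul_zero _)
  rw [hk']
  exact hs.unique (by rw [h0]; exact hasSum_zero)

theorem eq_zero_of_reflection_invariant {r : ℝ} (hr0 : 0 < r) (hr1 : r < 1) {G : ℂ → F}
    (hG : ∀ ζ : ℂ, ‖ζ‖ < 1 → DifferentiableAt ℂ G ζ) (h0 : G 0 = 0)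
    (hrefl : ∀ ζ : ℂ, r < ‖ζ‖ → ‖ζ‖ < 1 → G ζ = G (r / ζ)) {ζ : ℂ} (hζ : ‖ζ‖ < 1) :
    G ζ = 0 := by
  classical
  set T : ℂ → F := fun ζ => if ‖ζ‖ < 1 then G ζ else G (r / ζ) with hT
  have hTin : ∀ ζ : ℂ, ‖ζ‖ < 1 → T ζ = G ζ := fun ζ h => by simp [hT, h]
  have hTout : ∀ ζ : ℂ, r < ‖ζ‖ → T ζ = G (r / ζ) := fun ζ h => by
    by_cases h' : ‖ζ‖ < 1
    · rw [hTin ζ h', hrefl ζ h h']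
    · simp [hT, h']
  have hdiv : ∀ ζ : ℂ, r < ‖ζ‖ → ‖(r : ℂ) / ζ‖ < 1 := fun ζ h => by
    rw [norm_div, Complex.norm_real, Real.norm_of_nonneg hr0.le, div_lt_one (hr0.trans h)]
    exact h
  have hTd : Differentiable ℂ T := fun ζ => by
    by_cases h : ‖ζ‖ < 1
    · refine (hG ζ h).congr_of_eventuallyEq ?_
      filter_upwards [(isOpen_lt continuous_norm continuous_const).mem_nhds h] with x hx
      exact hTin x hx
    · have h' : r < ‖ζ‖ := by linarith
      have hz : ζ ≠ 0 := norm_pos_iff.1 (hr0.trans h')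
      have hd : DifferentiableAt ℂ (fun x : ℂ => G (r / x)) ζ :=
        (hG _ (hdiv ζ h')).comp ζ (f := fun x : ℂ => (r : ℂ) / x)
          ((differentiableAt_const _).div differentiableAt_id hz)
      refine hd.congr_of_eventuallyEq ?_
      filter_upwards [(isOpen_lt continuous_const continuous_norm).mem_nhds h'] with x hx
      exact hTout x hx
  have hb : Bornology.IsBounded (Set.range T) := by
    have hc := ((isCompact_closedBall (0 : ℂ) 1).image hTd.continuous).isBounded
    refine hc.subset ?_
    rintro _ ⟨x, rfl⟩
    by_cases h : ‖x‖ < 1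
    · exact ⟨x, by simpa using h.le, rfl⟩
    · have h' : r < ‖x‖ := by linarith
      refine ⟨r / x, by simpa using (hdiv x h').le, ?_⟩
      rw [hTout x h', hTin _ (hdiv x h')]
  rw [← hTin ζ hζ, hTd.apply_eq_apply_of_bounded hb ζ 0, hTin 0 (by simp), h0]

/-- Analytic continuation along the annulus `r < ‖ζ‖ < 1`, in the logarithmic coordinate. -/
theorem eq_reflection_of_eventually [CompleteSpace F] {r : ℝ} (hr0 : 0 < r)
    {G : ℂ → F} (hG : ∀ ζ : ℂ, ‖ζ‖ < 1 → DifferentiableAt ℂ G ζ) {ζ₀ : ℂ} (h₁ : r < ‖ζ₀‖)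
    (h₂ : ‖ζ₀‖ < 1) (hev : ∀ᶠ ζ in nhds ζ₀, G ζ = G (r / ζ)) {ζ : ℂ} (h₃ : r < ‖ζ‖)
    (h₄ : ‖ζ‖ < 1) : G ζ = G (r / ζ) := by
  set U : Set ℂ := {τ | Real.log r < τ.re} ∩ {τ | τ.re < 0} with hU
  have hUo : IsOpen U := (isOpen_lt continuous_const Complex.continuous_re).inter
    (isOpen_lt Complex.continuous_re continuous_const)
  have hUc : Convex ℝ U := (convex_halfSpace_re_gt _).inter (convex_halfSpace_re_lt _)
  have hlog : ∀ x : ℂ, r < ‖x‖ → ‖x‖ < 1 → Complex.log x ∈ U := fun x hx hx' => by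
    refine ⟨?_, ?_⟩
    · simpa [Complex.log_re] using Real.log_lt_log hr0 hx
    · simpa [Complex.log_re] using Real.log_neg (hr0.trans hx) hx'
  set f : ℂ → F := fun τ => G (Complex.exp τ) - G (r / Complex.exp τ) with hf
  have hfd : DifferentiableOn ℂ f U := fun τ hτ => by
    refine DifferentiableAt.differentiableWithinAt (DifferentiableAt.sub ?_ ?_)
    · refine (hG _ ?_).comp τ Complex.differentiable_exp.differentiableAt
      rw [Complex.norm_exp]
      exact Real.exp_lt_one_iff.2 hτ.2
    · refine (hG _ ?_).comp τ (f := fun τ : ℂ => (r : ℂ) / Complex.exp τ)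
        ((differentiableAt_const _).div Complex.differentiable_exp.differentiableAt
          (Complex.exp_ne_zero τ))
      rw [norm_div, Complex.norm_real, Real.norm_of_nonneg hr0.le, Complex.norm_exp,
        div_lt_one (Real.exp_pos _)]
      exact (Real.log_lt_iff_lt_exp hr0).1 hτ.1
  have hne : ∀ x : ℂ, r < ‖x‖ → x ≠ 0 := fun x hx => norm_pos_iff.1 (hr0.trans hx)
  have h0 : f =ᶠ[nhds (Complex.log ζ₀)] 0 := by
    have hc : Filter.Tendsto Complex.exp (nhds (Complex.log ζ₀)) (nhds ζ₀) := by
      have := Complex.continuous_exp.tendsto (Complex.log ζ₀)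
      rwa [Complex.exp_log (hne _ h₁)] at this
    filter_upwards [hc.eventually hev] with τ hτ
    simp [hf, hτ]
  have h := (hfd.analyticOnNhd hUo).eqOn_zero_of_preconnected_of_eventuallyEq_zero
    hUc.isPreconnected (hlog _ h₁ h₂) h0 (hlog _ h₃ h₄)
  simpa [hf, Complex.exp_log (hne _ h₃), sub_eq_zero] using h

/-- Let `T` invert `1 + r S²`. A bounded operator killing the orbit of `T (e - r S e)` under `T S`
kills the orbit of `e` under `S`. -/
theorem map_pow_eq_zero [CompleteSpace F] {r : ℝ} (hr0 : 0 < r) (hr1 : r < 1)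
    {S T : E →L[ℂ] E} (hS : ‖S‖ ≤ 1) (hT : ∀ x, T (x + (r : ℂ) • S (S x)) = x) {e : E}
    {π : E →L[ℂ] F} (hπ : ∀ n : ℕ, π (((T * S) ^ n) (T (e - (r : ℂ) • S e))) = 0) (n : ℕ) :
    π ((S ^ n) e) = 0 := by
  set a : E := e - (r : ℂ) • S e with ha
  set G : ℂ → F := fun ζ => π (ζ • resolv S ζ a) with hGdef
  have hG : ∀ ζ : ℂ, ‖ζ‖ < 1 → DifferentiableAt ℂ G ζ := fun ζ hζ => by
    have h := differentiableAt_resolv hS hζ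
    exact π.differentiableAt.comp ζ
      (differentiableAt_id.smul (h.clm_apply (differentiableAt_const a)))
  have hker : ∀ ζ η : ℂ, ‖ζ‖ < 1 → ‖η‖ < 1 → ζ * η = r → ‖(ζ + η) • (T * S)‖ < 1 →
      G ζ = G η := by
    intro ζ η hζ hη hr hs
    rw [← sub_eq_zero, hGdef]
    simp only
    rw [← map_sub, smul_resolv_sub_smul_resolv hS hζ hη, map_smul]
    rw [map_eq_zero_of_eq_add_smul hπ hs, smul_zero]
    have h1 := one_sub_smul_resolv hS hζ (resolv S η a)
    have h2 := one_sub_smul_resolv hS hη a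
    generalize resolv S ζ (resolv S η a) = k at *
    rw [← h1] at h2
    have h3 : k + (r : ℂ) • S (S k) = (ζ + η) • S k + a := by
      rw [← h2, ← hr]
      simp only [map_sub, map_smul]
      module
    have h4 := congrArg T h3
    rw [hT, map_add, map_smul] at h4
    exact h4
  have hsq : Real.sqrt r * Real.sqrt r = r := Real.mul_self_sqrt hr0.le
  have hsq0 : 0 < Real.sqrt r := Real.sqrt_pos.2 hr0
  set ζ₀ : ℂ := Complex.I * Real.sqrt r with hζ₀
  have hn : ‖ζ₀‖ = Real.sqrt r := by simp [hζ₀, abs_of_pos hsq0]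
  have hlt1 : ‖ζ₀‖ < 1 := by rw [hn]; nlinarith
  have hltr : r < ‖ζ₀‖ := by rw [hn]; rw [hn] at hlt1; nlinarith
  have hne : ζ₀ ≠ 0 := norm_pos_iff.1 (hr0.trans hltr)
  have hdiv : (r : ℂ) / ζ₀ = -ζ₀ := by
    rw [div_eq_iff hne, hζ₀]
    have : ((Real.sqrt r : ℝ) : ℂ) * Real.sqrt r = r := by exact_mod_cast hsq
    linear_combination (-1 : ℂ) * this + (Real.sqrt r : ℂ) ^ 2 * Complex.I_mul_I
  have hev : ∀ᶠ ζ in nhds ζ₀, G ζ = G (r / ζ) := by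
    have hc : ContinuousAt (fun ζ : ℂ => (r : ℂ) / ζ) ζ₀ := by
      exact continuousAt_const.div continuousAt_id hne
    have hc2 : ContinuousAt (fun ζ : ℂ => ‖(ζ + (r : ℂ) / ζ) • (T * S)‖) ζ₀ :=
      ((continuousAt_id.add hc).smul continuousAt_const).norm
    have e1 : ∀ᶠ ζ : ℂ in nhds ζ₀, ‖ζ‖ < 1 := continuous_norm.continuousAt.eventually_lt
      continuousAt_const hlt1
    have e2 : ∀ᶠ ζ : ℂ in nhds ζ₀, ‖(r : ℂ) / ζ‖ < 1 := hc.norm.eventually_lt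
      continuousAt_const (by rw [hdiv, norm_neg]; exact hlt1)
    have e3 := hc2.eventually_lt (g := fun _ => (1 : ℝ)) continuousAt_const (by simp [hdiv])
    filter_upwards [e1, e2, e3, isOpen_ne.mem_nhds hne] with ζ h1 h2 h3 h4
    exact hker ζ _ h1 h2 (mul_div_cancel₀ _ h4) h3
  have hG0 : ∀ ζ : ℂ, ‖ζ‖ < 1 → G ζ = 0 := fun ζ hζ =>
    eq_zero_of_reflection_invariant hr0 hr1 hG (by simp [hGdef])
      (fun x hx hx' => eq_reflection_of_eventually hr0 hG hltr hlt1 hev hx hx') hζ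
  have hzero : ∀ A : E →L[ℂ] E, (∀ ζ : ℂ, ‖ζ‖ < 1 → ζ ≠ 0 → π (A (resolv S ζ a)) = 0) →
      ∀ ζ : ℂ, ‖ζ‖ < 1 → π (A (resolv S ζ a)) = 0 := by
    intro A hA ζ hζ
    by_cases hz : ζ = 0
    · subst hz
      have hc : ContinuousAt (fun ζ : ℂ => π (A (resolv S ζ a))) 0 :=
        (π.comp A).continuous.continuousAt.comp
          ((differentiableAt_resolv hS hζ).continuousAt.clm_apply continuousAt_const)
      have ht := hc.tendsto.mono_left (nhdsWithin_le_nhds (s := {0}ᶜ))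
      refine tendsto_nhds_unique ht (tendsto_const_nhds.congr' ?_)
      filter_upwards [self_mem_nhdsWithin, mem_nhdsWithin_of_mem_nhds
        ((isOpen_lt continuous_norm continuous_const).mem_nhds hζ)] with x hx hx'
      exact (hA x hx' hx).symm
    · exact hA ζ hζ hz
  have hall : ∀ n : ℕ, ∀ ζ : ℂ, ‖ζ‖ < 1 → π ((S ^ n) (resolv S ζ a)) = 0 := by
    intro n
    induction n with
    | zero =>
      refine hzero _ fun ζ hζ hz => ?_
      have := hG0 ζ hζ
      simp only [hGdef, map_smul, smul_eq_zero, hz, false_or] at this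
      simpa using this
    | succ n ih =>
      refine hzero _ fun ζ hζ hz => ?_
      have h1 := one_sub_smul_resolv hS hζ a
      have h2 : resolv S 0 a = a := by simp [resolv]
      have h3 := ih 0 (by simp)
      rw [h2, ← h1, map_sub, map_sub, ih ζ hζ, zero_sub, neg_eq_zero, map_smul, map_smul,
        smul_eq_zero] at h3
      simpa [pow_succ, hz] using h3
  have hr : ‖(r : ℂ)‖ < 1 := by simpa [abs_of_pos hr0] using hr1
  have := hall n r hr
  rwa [ha, resolv_one_sub_smul hS hr] at this

end Resolvent

section SequenceSpace

/-- The Banach space `ℓ¹`. -/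
abbrev EllOne : Type := lp (fun _ : ℕ => ℂ) 1

theorem EllOne.summable_norm (x : EllOne) : Summable fun n => ‖x n‖ := by
  simpa using (lp.hasSum_norm (by simp) x).summable

theorem EllOne.norm_eq_tsum (x : EllOne) : ‖x‖ = ∑' n, ‖x n‖ := by
  simpa using lp.norm_eq_tsum_rpow (by simp) x

theorem EllOne.norm_apply_le (x : EllOne) (n : ℕ) : ‖x n‖ ≤ ‖x‖ :=
  lp.norm_apply_le_norm one_ne_zero x n

/-- The right shift of a sequence. -/
def shiftSeq (x : ℕ → ℂ) : ℕ → ℂ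
  | 0 => 0
  | n + 1 => x n

theorem memℓp_shiftSeq (x : EllOne) : Memℓp (shiftSeq x) 1 := by
  refine memℓp_gen ?_
  rw [← summable_nat_add_iff 1]
  simpa [shiftSeq] using x.summable_norm

/-- The right shift on `ℓ¹`. -/
noncomputable def shift : EllOne →L[ℂ] EllOne :=
  LinearMap.mkContinuous
    { toFun := fun x => ⟨shiftSeq x, memℓp_shiftSeq x⟩
      map_add' := fun x y => by
        ext n
        cases n
        · exact (add_zero (0 : ℂ)).symm
        · rfl
      map_smul' := fun c x => by
        ext n
        cases n <;> simp [shiftSeq] } 1 fun x => by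
      rw [one_mul, EllOne.norm_eq_tsum, EllOne.norm_eq_tsum,
        Summable.tsum_eq_zero_add (EllOne.summable_norm _)]
      simp [shiftSeq]

@[simp] theorem shift_apply_zero (x : EllOne) : shift x 0 = 0 := rfl

@[simp] theorem shift_apply_succ (x : EllOne) (n : ℕ) : shift x (n + 1) = x n := rfl

theorem norm_shift_le : ‖shift‖ ≤ 1 := LinearMap.mkContinuous_norm_le _ zero_le_one _

theorem shift_pow_single (n : ℕ) :
    (shift ^ n) (lp.single 1 0 (1 : ℂ)) = lp.single 1 n (1 : ℂ) := by
  induction n with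
  | zero => simp
  | succ n ih =>
    rw [pow_succ', mul_apply_eq_comp, ih]
    ext i
    cases i with
    | zero => simp [lp.single_apply]
    | succ i => simp [lp.single_apply, Pi.single_apply]

/-- `W_p` as a linear map on all sequences. -/
noncomputable def WopLin (p : ℝ) : (ℕ → ℂ) →ₗ[ℂ] (ℕ → ℂ) where
  toFun := Wop p
  map_add' x y := by
    funext i
    by_cases h : i = 0 <;> simp [Wop, h] <;> ring
  map_smul' c x := by
    funext i
    by_cases h : i = 0 <;> simp [Wop, h] <;> ring

theorem WopLin_pow_apply (p : ℝ) (n : ℕ) (x : ℕ → ℂ) : (WopLin p ^ n) x = (Wop p)^[n] x := by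
  rw [Module.End.pow_apply]
  rfl

theorem Wop_iterate_eq_zero_of_le {p : ℝ} {x : ℕ → ℂ} {m n : ℕ} (hmn : m ≤ n)
    (h : (Wop p)^[m] x = 0) : (Wop p)^[n] x = 0 := by
  rw [← WopLin_pow_apply] at *
  obtain ⟨k, rfl⟩ := Nat.exists_eq_add_of_le' hmn
  rw [pow_add, Module.End.mul_apply, h, map_zero]

/-- The elements of `ℓ¹` killed by some power of `W_p`. -/
noncomputable def WopKer (p : ℝ) : Submodule ℂ EllOne where
  carrier := {x | ∃ n : ℕ, 1 ≤ n ∧ (Wop p)^[n] (x : ℕ → ℂ) = 0}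
  zero_mem' := ⟨1, le_rfl, by
    rw [← WopLin_pow_apply, lp.coeFn_zero, map_zero]⟩
  add_mem' := by
    rintro x y ⟨m, hm, hx⟩ ⟨n, hn, hy⟩
    refine ⟨m + n, by omega, ?_⟩
    have hx' := Wop_iterate_eq_zero_of_le (Nat.le_add_right m n) hx
    have hy' := Wop_iterate_eq_zero_of_le (Nat.le_add_left n m) hy
    rw [← WopLin_pow_apply] at *
    rw [lp.coeFn_add, map_add, hx', hy', add_zero]
  smul_mem' := by
    rintro c x ⟨m, hm, hx⟩
    refine ⟨m, hm, ?_⟩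
    rw [← WopLin_pow_apply] at *
    rw [lp.coeFn_smul, map_smul, hx, smul_zero]

theorem exists_inverse_one_add_smul_shift_sq {r : ℝ} (hr0 : 0 < r) (hr1 : r < 1) :
    ∃ T : EllOne →L[ℂ] EllOne, (∀ x, T (x + (r : ℂ) • shift (shift x)) = x) ∧
      ∀ x, T x + (r : ℂ) • shift (shift (T x)) = x := by
  have hS : ‖shift * shift‖ ≤ 1 := (norm_mul_le _ _).trans
    (mul_le_one₀ norm_shift_le (norm_nonneg _) norm_shift_le)
  have hr : ‖-(r : ℂ)‖ < 1 := by simpa [abs_of_pos hr0] using hr1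
  refine ⟨resolv (shift * shift) (-r), fun x => ?_, fun x => ?_⟩
  · simpa using resolv_one_sub_smul hS hr x
  · simpa using one_sub_smul_resolv hS hr x

theorem map_pow_mem_WopKer {p : ℝ} {V : EllOne →L[ℂ] EllOne} {u : EllOne}
    (hV : ∀ y : EllOne, Wop p (V y) = (p : ℂ) • (y : ℕ → ℂ)) (hu : Wop p u = 0) (n : ℕ) :
    (V ^ n) u ∈ WopKer p := by
  refine ⟨n + 1, by omega, ?_⟩
  induction n with
  | zero => simpa using hu
  | succ n ih =>
    rw [Function.iterate_succ_apply, pow_succ', mul_apply_eq_comp, hV, ← WopLin_pow_apply,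
      map_smul, WopLin_pow_apply, ih, smul_zero]

theorem Wop_eq {p r : ℝ} (hr : p * r = 1 - p) {v w : ℕ → ℂ} (h0 : p * v 1 + (1 - p) * v 0 = p * w 0)
    (h : ∀ i, v (i + 2) + r * v i = w (i + 1)) : Wop p v = (p : ℂ) • w := by
  have hr' : (p : ℂ) * r = 1 - p := by exact_mod_cast hr
  funext i
  cases i with
  | zero =>
    simp only [Wop, if_true, Pi.smul_apply, smul_eq_mul]
    push_cast
    linear_combination h0
  | succ i =>
    simp only [Wop, Nat.succ_ne_zero, if_false, Pi.smul_apply, smul_eq_mul, Nat.add_sub_cancel]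
    push_cast
    linear_combination (p : ℂ) * h i - v i * hr'

theorem dense_WopKer {p : ℝ} (hp : 1 / 2 < p) (hp1 : p < 1) :
    Dense (WopKer p : Set EllOne) := by
  have hp0 : 0 < p := by linarith
  set r : ℝ := (1 - p) / p with hr
  have hr0 : 0 < r := div_pos (by linarith) hp0
  have hr1 : r < 1 := by rw [hr, div_lt_one hp0]; linarith
  have hpr : p * r = 1 - p := mul_div_cancel₀ _ hp0.ne'
  have hpr' : (p : ℂ) * r = 1 - p := by exact_mod_cast hpr
  obtain ⟨T, hT, hT'⟩ := exists_inverse_one_add_smul_shift_sq hr0 hr1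
  have hcoord : ∀ x : EllOne, T x 0 = x 0 ∧ T x 1 = x 1 ∧
      ∀ i, T x (i + 2) + r * T x i = x (i + 2) := fun x => by
    have h : ∀ i, T x i + r * shift (shift (T x)) i = x i := fun i =>
      congrArg (fun y : EllOne => y i) (hT' x)
    refine ⟨by simpa using h 0, by simpa using h 1, fun i => h (i + 2)⟩
  set e : EllOne := lp.single 1 0 (1 : ℂ) with he
  have hV : ∀ y : EllOne, Wop p ((T * shift) y) = (p : ℂ) • (y : ℕ → ℂ) := fun y => by
    obtain ⟨h0, h1, h2⟩ := hcoord (shift y)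
    refine Wop_eq hpr ?_ fun i => h2 i
    rw [mul_apply_eq_comp, h0, h1]
    simp
  have hu : Wop p (T (e - (r : ℂ) • shift e)) = 0 := by
    obtain ⟨h0, h1, h2⟩ := hcoord (e - (r : ℂ) • shift e)
    have ha : ∀ i, (e - (r : ℂ) • shift e) i = e i - r * shift e i := fun _ => rfl
    rw [Wop_eq hpr (w := 0) ?_ fun i => ?_, smul_zero]
    · rw [h0, h1, ha, ha]
      simp [he, lp.single_apply]
      linear_combination -hpr'
    · rw [h2, ha]
      simp [he, lp.single_apply]
  set L : Submodule ℂ EllOne := (WopKer p).topologicalClosure with hL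
  have : IsClosed (L : Set EllOne) := Submodule.isClosed_topologicalClosure _
  have hmem : ∀ n : ℕ, lp.single 1 n (1 : ℂ) ∈ L := fun n => by
    have h := map_pow_eq_zero hr0 hr1 norm_shift_le hT (e := e) (π := L.mkQL) (fun n => by
      rw [Submodule.mkQL_apply, Submodule.mkQ_apply, Submodule.Quotient.mk_eq_zero]
      exact Submodule.le_topologicalClosure _ (map_pow_mem_WopKer hV hu n)) n
    rwa [he, shift_pow_single, Submodule.mkQL_apply, Submodule.mkQ_apply,
      Submodule.Quotient.mk_eq_zero] at h
  rw [Submodule.dense_iff_topologicalClosure_eq_top, eq_top_iff]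
  intro x _
  refine (Submodule.isClosed_topologicalClosure (WopKer p)).mem_of_tendsto
    (lp.hasSum_single ENNReal.one_ne_top x) (Filter.Eventually.of_forall fun s => ?_)
  refine Submodule.sum_mem _ fun i _ => ?_
  have : lp.single (E := fun _ : ℕ => ℂ) 1 i (x i) = x i • lp.single 1 i (1 : ℂ) := by
    rw [← lp.single_smul, smul_eq_mul, mul_one]
  rw [this]
  exact Submodule.smul_mem _ _ (hmem i)

/-- Finitely supported sequences are `ℓ¹`-limits of elements killed by a power of `W_p`. -/
theorem exists_mem_WopKer_near_truncation {p : ℝ} (hp : 1 / 2 < p) (hp1 : p < 1) (z : ℕ → ℂ)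
    (N : ℕ) {δ : ℝ} (hδ : 0 < δ) :
    ∃ x y : EllOne, x ∈ WopKer p ∧ ‖x - y‖ < δ ∧ ∀ i, y i = if i < N then z i else 0 := by
  have hy : Memℓp (fun i => if i < N then z i else 0) 1 :=
    memℓp_gen (summable_of_ne_finset_zero (s := Finset.range N) fun i hi => by
      simp only [Finset.mem_range] at hi
      simp [hi])
  obtain ⟨x, hx, hd⟩ := (dense_WopKer hp hp1).exists_dist_lt ⟨_, hy⟩ hδ
  exact ⟨x, ⟨_, hy⟩, hx, by rwa [dist_comm, dist_eq_norm] at hd, fun i => rfl⟩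

theorem EllOne.memc0 (x : EllOne) : memc0 x := by
  rw [_root_.memc0, tendsto_zero_iff_norm_tendsto_zero]
  exact x.summable_norm.tendsto_atTop_zero

theorem EllOne.memlq {q : ℝ} (hq : 1 ≤ q) (x : EllOne) : memlq q x := by
  have h1 : ∀ᶠ n in Filter.atTop, ‖x n‖ ≤ 1 :=
    (x.summable_norm.tendsto_atTop_zero.eventually_lt_const one_pos).mono fun _ => le_of_lt
  refine Summable.of_norm_bounded_eventually_nat x.summable_norm (h1.mono fun n hn => ?_)
  rw [Real.norm_of_nonneg (by positivity)]
  exact (Real.rpow_le_rpow_of_exponent_ge' (norm_nonneg _) hn zero_le_one hq).trans_eq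
    (Real.rpow_one _)

theorem EllOne.tsum_rpow_le {q : ℝ} (hq : 1 ≤ q) (x : EllOne) (hx : ‖x‖ ≤ 1) :
    ∑' n, ‖x n‖ ^ q ≤ ‖x‖ := by
  rw [x.norm_eq_tsum]
  refine (x.memlq hq).tsum_le_tsum (fun n => ?_) x.summable_norm
  exact (Real.rpow_le_rpow_of_exponent_ge' (norm_nonneg _) ((x.norm_apply_le n).trans hx)
    zero_le_one hq).trans_eq (Real.rpow_one _)

theorem norm_add_rpow_le {q : ℝ} (hq : 1 ≤ q) (a b : ℂ) :
    ‖a + b‖ ^ q ≤ 2 ^ (q - 1) * (‖a‖ ^ q + ‖b‖ ^ q) := by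
  refine (Real.rpow_le_rpow (norm_nonneg _) (norm_add_le a b) (by linarith)).trans ?_
  exact_mod_cast NNReal.rpow_add_le_mul_rpow_add_rpow ‖a‖₊ ‖b‖₊ hq

end SequenceSpace

/-- For `p ∈ (1/2, 1)` and `X = c₀` or `X = ℓ^q` (`q ≥ 1`), the union of kernels
`D = ⋃_{n ≥ 1} Ker(W_p^n)` is dense in `X`: every `z ∈ X` is approximated within any
`ε > 0` by some `u ∈ X` with `W_p^n u = 0` for some `n ≥ 1`. -/
theorem stmt13 (p : ℝ) (hp : 1/2 < p) (hp1 : p < 1) :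
    (∀ z, memc0 z → ∀ ε : ℝ, 0 < ε →
      ∃ u, memc0 u ∧ (∃ n : ℕ, 1 ≤ n ∧ (Wop p)^[n] u = 0) ∧ distC0lt u z ε) ∧
    (∀ q : ℝ, 1 ≤ q → ∀ z, memlq q z → ∀ ε : ℝ, 0 < ε →
      ∃ u, memlq q u ∧ (∃ n : ℕ, 1 ≤ n ∧ (Wop p)^[n] u = 0) ∧ distLqlt q u z ε) := by
  refine ⟨fun z hz ε hε => ?_, fun q hq z hz ε hε => ?_⟩
  · obtain ⟨N, hN⟩ := Filter.eventually_atTop.1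
      ((tendsto_zero_iff_norm_tendsto_zero.1 hz).eventually_lt_const (half_pos hε))
    obtain ⟨x, y, hx, hxy, hy⟩ := exists_mem_WopKer_near_truncation hp hp1 z N (half_pos hε)
    refine ⟨x, x.memc0, hx, fun i => ?_⟩
    have h1 : ‖x i - y i‖ < ε / 2 := ((x - y).norm_apply_le i).trans_lt hxy
    have h2 : ‖y i - z i‖ ≤ ε / 2 := by
      rw [hy]
      split_ifs with h
      · simpa using (half_pos hε).le
      · simpa using (hN i (not_lt.1 h)).le
    calc ‖x i - z i‖ ≤ ‖x i - y i‖ + ‖y i - z i‖ := norm_sub_le_norm_sub_add_norm_sub _ _ _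
      _ < ε := by linarith
  · set C : ℝ := 2 ^ (q - 1) with hC
    have hC0 : 0 < C := by positivity
    have hη : 0 < ε / (2 * C) := by positivity
    obtain ⟨N, hN⟩ := ((tendsto_sum_nat_add fun n => ‖z n‖ ^ q).eventually_lt_const hη).exists
    obtain ⟨x, y, hx, hxy, hy⟩ := exists_mem_WopKer_near_truncation hp hp1 z N
      (lt_min one_pos hη)
    refine ⟨x, x.memlq hq, hx, ?_⟩
    have hq0 : q ≠ 0 := by linarith
    have hyz0 : ∀ i, i < N → ‖y i - z i‖ ^ q = 0 := fun i hi => by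
      simp [hy, hi, Real.zero_rpow hq0]
    have hyzN : (fun i => ‖y (i + N) - z (i + N)‖ ^ q) = fun i => ‖z (i + N)‖ ^ q := by
      funext i
      simp [hy]
    have hs2 : Summable fun i => ‖y i - z i‖ ^ q := by
      rw [← summable_nat_add_iff N, hyzN]
      exact (summable_nat_add_iff N).2 hz
    have ht2 : ∑' i, ‖y i - z i‖ ^ q < ε / (2 * C) := by
      rwa [← hs2.sum_add_tsum_nat_add N, hyzN,
        Finset.sum_eq_zero fun i hi => hyz0 i (Finset.mem_range.1 hi), zero_add]
    have hs1 : Summable fun i => ‖x i - y i‖ ^ q := (x - y).memlq hq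
    have ht1 : ∑' i, ‖x i - y i‖ ^ q < ε / (2 * C) :=
      ((x - y).tsum_rpow_le hq (hxy.le.trans (min_le_left _ _))).trans_lt
        (hxy.trans_le (min_le_right _ _))
    have hle : ∀ i, ‖x i - z i‖ ^ q ≤ C * (‖x i - y i‖ ^ q + ‖y i - z i‖ ^ q) := fun i => by
      simpa using norm_add_rpow_le hq (x i - y i) (y i - z i)
    have hs3 := (hs1.add hs2).mul_left C
    have hs : Summable fun i => ‖x i - z i‖ ^ q :=
      Summable.of_nonneg_of_le (fun i => by positivity) hle hs3
    calc ∑' i, ‖x i - z i‖ ^ q ≤ ∑' i, C * (‖x i - y i‖ ^ q + ‖y i - z i‖ ^ q) :=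
          hs.tsum_le_tsum hle hs3
      _ = C * (∑' i, ‖x i - y i‖ ^ q + ∑' i, ‖y i - z i‖ ^ q) := by
          rw [tsum_mul_left, hs1.tsum_add hs2]
      _ < C * (ε / (2 * C) + ε / (2 * C)) := by gcongr
      _ = ε := by field_simp; norm_num
end
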